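/- Let n ≥ 2, let X ⊆ ℝⁿ be closed and let s ∈ ℝⁿ with s ∉ X. Then the shadow of X from the light source s, namely Sh = {y ∈ ℝⁿ : the closed segment [s, y] meets X}, satisfies dimH Sh ≤ dimH X + 1. -/

import Mathlib

open MeasureTheory Set Filter Topology
open scoped ENNReal NNReal

/-- A set of diameter at most `ρ` times a unit interval is covered by at most `ρ⁻¹ + 1` pieces of
diameter at most `ρ`. -/
lemma mkMetric'_pre_prod_Icc_le {E : Type*} [EMetricSpace E] {d : ℝ} (hd : 0 ≤ d) (a : ℝ)
    {t : Set E} {r : ℝ≥0∞} {ρ : ℝ} (hρ : 0 < ρ) (hρ1 : ρ ≤ 1) (hρr : ENNReal.ofReal ρ ≤ r)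
    (ht : Metric.ediam t ≤ ENNReal.ofReal ρ) :
    OuterMeasure.mkMetric'.pre (fun s : Set (E × ℝ) => Metric.ediam s ^ (d + 1)) r
      (t ×ˢ Icc a (a + 1)) ≤ 2 * ENNReal.ofReal ρ ^ d := by
  set κ := OuterMeasure.mkMetric'.pre (fun s : Set (E × ℝ) => Metric.ediam s ^ (d + 1)) r
  let J : ℕ → Set ℝ := fun k => Icc (a + k * ρ) (a + (k + 1) * ρ)
  let N := ⌊1 / ρ⌋₊ + 1
  have hpiece (k : ℕ) : κ (t ×ˢ J k) ≤ ENNReal.ofReal ρ ^ (d + 1) := by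
    have hJ : Metric.ediam (J k) ≤ ENNReal.ofReal ρ := by
      rw [Real.ediam_Icc]
      exact ENNReal.ofReal_le_ofReal (by linarith)
    have hdiam : Metric.ediam (t ×ˢ J k) ≤ ENNReal.ofReal ρ :=
      Metric.ediam_le fun x hx y hy => max_le
        ((Metric.edist_le_ediam_of_mem hx.1 hy.1).trans ht)
        ((Metric.edist_le_ediam_of_mem hx.2 hy.2).trans hJ)
    exact (OuterMeasure.mkMetric'.pre_le (hdiam.trans hρr)).trans (by gcongr)
  have hcover : t ×ˢ Icc a (a + 1) ⊆ ⋃ k ∈ Finset.range N, t ×ˢ J k := by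
    rintro ⟨x, u⟩ ⟨hx, hu⟩
    have hu0 : 0 ≤ (u - a) / ρ := div_nonneg (sub_nonneg.2 hu.1) hρ.le
    refine mem_iUnion₂.2 ⟨⌊(u - a) / ρ⌋₊, ?_, hx, ?_, ?_⟩
    · refine Finset.mem_range.2 (Nat.lt_succ_of_le (Nat.floor_le_floor ?_))
      gcongr
      linarith [hu.2]
    · linarith [(le_div_iff₀ hρ).1 (Nat.floor_le hu0)]
    · linarith [(div_lt_iff₀ hρ).1 (Nat.lt_floor_add_one ((u - a) / ρ))]
  have hNρ : (N : ℝ≥0∞) * ENNReal.ofReal ρ ≤ 2 := by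
    have hN : (N : ℝ) * ρ ≤ 2 := by
      have h := (le_div_iff₀ hρ).1 (Nat.floor_le (one_div_nonneg.2 hρ.le))
      push_cast [N]
      linarith
    rw [← ENNReal.ofReal_natCast, ← ENNReal.ofReal_mul N.cast_nonneg]
    simpa using ENNReal.ofReal_le_ofReal hN
  calc
    κ (t ×ˢ Icc a (a + 1)) ≤ ∑ k ∈ Finset.range N, κ (t ×ˢ J k) :=
      (measure_mono hcover).trans (measure_biUnion_finset_le _ _)
    _ ≤ ∑ _k ∈ Finset.range N, ENNReal.ofReal ρ ^ (d + 1) :=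
      Finset.sum_le_sum fun k _ => hpiece k
    _ = N * ENNReal.ofReal ρ * ENNReal.ofReal ρ ^ d := by
      rw [Finset.sum_const, Finset.card_range, nsmul_eq_mul, add_comm d,
        ENNReal.rpow_add _ _ (by simpa using hρ) ENNReal.ofReal_ne_top, ENNReal.rpow_one, mul_assoc]
    _ ≤ 2 * ENNReal.ofReal ρ ^ d := by gcongr

lemma mkMetric'_pre_prod_Icc_le_ediam {E : Type*} [EMetricSpace E] {d : ℝ} (hd : 0 ≤ d) (a : ℝ)
    {t : Set E} {r : ℝ≥0∞} (hr : r ≤ 1) (ht : Metric.ediam t < r) :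
    OuterMeasure.mkMetric'.pre (fun s : Set (E × ℝ) => Metric.ediam s ^ (d + 1)) r
      (t ×ˢ Icc a (a + 1)) ≤ 2 * Metric.ediam t ^ d := by
  have hlim : Tendsto (fun ρ : ℝ≥0∞ => 2 * ρ ^ d) (𝓝[>] Metric.ediam t)
      (𝓝 (2 * Metric.ediam t ^ d)) :=
    (ENNReal.Tendsto.const_mul (ENNReal.continuous_rpow_const.tendsto _)
      (Or.inr ENNReal.ofNat_ne_top)).mono_left nhdsWithin_le_nhds
  have : (𝓝[>] Metric.ediam t).NeBot := nhdsGT_neBot_of_exists_gt ⟨r, ht⟩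
  refine ge_of_tendsto hlim ?_
  filter_upwards [Ioo_mem_nhdsGT ht] with ρ hρ
  have hρ1 : ρ ≤ 1 := hρ.2.le.trans hr
  have hofReal : ENNReal.ofReal ρ.toReal = ρ :=
    ENNReal.ofReal_toReal (hρ1.trans_lt ENNReal.one_lt_top).ne
  have h := mkMetric'_pre_prod_Icc_le hd (t := t) (r := r) (ρ := ρ.toReal) a
    (ENNReal.toReal_pos hρ.1.pos.ne' (hρ1.trans_lt ENNReal.one_lt_top).ne)
    (ENNReal.toReal_mono ENNReal.one_ne_top hρ1) (hofReal.trans_le hρ.2.le)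
    (hρ.1.le.trans_eq hofReal.symm)
  rwa [hofReal] at h

lemma hausdorffMeasure_prod_Icc_le {E : Type*} [EMetricSpace E] [SecondCountableTopology E]
    [MeasurableSpace E] [BorelSpace E] {d : ℝ} (hd : 0 ≤ d) (A : Set E) (a : ℝ) :
    μH[d + 1] (A ×ˢ Icc a (a + 1)) ≤ 2 * μH[d] A := by
  rw [Measure.hausdorffMeasure, Measure.hausdorffMeasure, ← OuterMeasure.coe_mkMetric,
    ← OuterMeasure.coe_mkMetric]
  refine le_of_tendsto (OuterMeasure.mkMetric'.tendsto_pre _ _) ?_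
  filter_upwards [Ioo_mem_nhdsGT (zero_lt_one (α := ℝ≥0∞))] with r hr
  let κ := OuterMeasure.mkMetric'.pre (fun s : Set (E × ℝ) => Metric.ediam s ^ (d + 1)) r
  let ν : OuterMeasure E :=
    OuterMeasure.map Prod.fst (OuterMeasure.restrict (univ ×ˢ Icc a (a + 1)) κ)
  have hν (t : Set E) : ν t = κ (t ×ˢ Icc a (a + 1)) := by
    simp [ν, ← prod_univ, prod_inter_prod]
  have hr2 : r / 2 < r := ENNReal.half_lt_self hr.1.ne' (hr.2.trans ENNReal.one_lt_top).ne
  have hle : (2⁻¹ : ℝ≥0∞) • ν ≤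
      OuterMeasure.mkMetric'.pre (fun s : Set E => Metric.ediam s ^ d) (r / 2) := by
    refine OuterMeasure.mkMetric'.le_pre.2 fun t ht => ?_
    rw [smul_apply, smul_eq_mul, hν,
      ENNReal.inv_mul_le_iff two_ne_zero ENNReal.ofNat_ne_top]
    exact mkMetric'_pre_prod_Icc_le_ediam hd a hr.2.le (ht.trans_lt hr2)
  have hpre : OuterMeasure.mkMetric'.pre (fun s : Set E => Metric.ediam s ^ d) (r / 2) ≤
      OuterMeasure.mkMetric fun x => x ^ d :=
    le_iSup₂_of_le (f := fun r (_ : r > 0) => OuterMeasure.mkMetric'.pre _ r) (r / 2)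
      (ENNReal.half_pos hr.1.ne') le_rfl
  have h := (hle.trans hpre) A
  rwa [smul_apply, smul_eq_mul, hν,
    ENNReal.inv_mul_le_iff two_ne_zero ENNReal.ofNat_ne_top] at h

lemma dimH_prod_Icc_le {E : Type*} [EMetricSpace E] [SecondCountableTopology E]
    (A : Set E) (a : ℝ) : dimH (A ×ˢ Icc a (a + 1)) ≤ dimH A + 1 := by
  borelize E
  refine le_of_forall_gt fun c hc => ?_
  obtain ⟨d, hAd, hdc⟩ := ENNReal.lt_iff_exists_nnreal_btwn.1 (lt_tsub_iff_right.2 hc)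
  have hnull : μH[((d + 1 : ℝ≥0) : ℝ)] (A ×ˢ Icc a (a + 1)) = 0 := by
    have h := hausdorffMeasure_prod_Icc_le d.coe_nonneg A a
    rw [hausdorffMeasure_of_dimH_lt hAd, mul_zero] at h
    simpa using h
  refine (dimH_le_of_hausdorffMeasure_ne_top (hnull ▸ ENNReal.zero_ne_top)).trans_lt ?_
  simpa using lt_tsub_iff_right.1 hdc

lemma dimH_prod_univ_real_le {E : Type*} [EMetricSpace E] [SecondCountableTopology E]
    (A : Set E) : dimH (A ×ˢ (univ : Set ℝ)) ≤ dimH A + 1 := by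
  have hcover : A ×ˢ (univ : Set ℝ) = ⋃ k : ℤ, A ×ˢ Icc (k : ℝ) (k + 1) := by
    rw [← prod_iUnion, iUnion_Icc_intCast]
  rw [hcover, dimH_iUnion]
  exact iSup_le fun k => dimH_prod_Icc_le A k

/-- The shadow of a closed set `X` from a light source `s ∉ X` has Hausdorff
dimension at most `dimH X + 1`. -/
theorem dimH_shadow_le
    (n : ℕ) (hn : 2 ≤ n) (X : Set (EuclideanSpace ℝ (Fin n))) (hX : IsClosed X)
    (s : EuclideanSpace ℝ (Fin n)) (hs : s ∉ X) :
    dimH {y : EuclideanSpace ℝ (Fin n) | (segment ℝ s y ∩ X).Nonempty} ≤ dimH X + 1 := by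
  let f : EuclideanSpace ℝ (Fin n) × ℝ → EuclideanSpace ℝ (Fin n) := fun p => s + p.2 • (p.1 - s)
  have hf : ContDiff ℝ 1 f := by fun_prop
  have hsub : {y | (segment ℝ s y ∩ X).Nonempty} ⊆ f '' (X ×ˢ univ) := by
    rintro y ⟨x, hxy, hx⟩
    rw [segment_eq_image'] at hxy
    obtain ⟨t, -, rfl⟩ := hxy
    have ht : t ≠ 0 := by
      rintro rfl
      simp [hs] at hx
    exact ⟨(s + t • (y - s), t⁻¹), ⟨hx, mem_univ _⟩, by simp [f, smul_smul, ht]⟩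
  calc
    _ ≤ dimH (f '' (X ×ˢ univ)) := dimH_mono hsub
    _ ≤ dimH (X ×ˢ (univ : Set ℝ)) :=
      hf.contDiffOn.dimH_image_le convex_univ (subset_univ _)
    _ ≤ dimH X + 1 := dimH_prod_univ_real_le X
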